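/- Fix 0 < s < 1, k ∈ ℤ, ξ ∈ ℝ, and define D_{n,k}(ξ) = (1/2π) ∫₀^{2π} e^{ikθ} U_{n−1}(s cos(θ + ξ/n)) U_{n−1}(s cos θ) dθ. Then lim_{n→∞} D_{n,k}(ξ) = ((1 + (−1)ᵏ)/(4π)) ∫_{−s}^{s} e_k(x) cos(ξ √(s² − x²)/√(1 − x²)) dx/((1 − x²)√(s² − x²)), where e_k(x) = exp(i k arccos(x/s)). -/

import Mathlib

/-- `e_k(x) = exp(i k arccos(x/s))`. -/
noncomputable def ek (s : ℝ) (k : ℤ) (x : ℝ) : ℂ :=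
  Complex.exp (Complex.I * k * Real.arccos (x / s))

/-- `D_{n,k}(ξ) = (1/2π) ∫₀^{2π} e^{ikθ} U_{n−1}(s cos(θ + ξ/n)) U_{n−1}(s cos θ) dθ`. -/
noncomputable def Dnk (s : ℝ) (k : ℤ) (ξ : ℝ) (n : ℕ) : ℂ :=
  ((1 / (2 * Real.pi) : ℝ) : ℂ) * ∫ θ in (0:ℝ)..(2 * Real.pi),
    Complex.exp (Complex.I * k * θ) *
      Complex.ofReal ((Polynomial.Chebyshev.U ℝ ((n : ℤ) - 1)).eval (s * Real.cos (θ + ξ / n))) *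
      Complex.ofReal ((Polynomial.Chebyshev.U ℝ ((n : ℤ) - 1)).eval (s * Real.cos θ))

open Filter MeasureTheory Set Topology

/-- A form of the **Riemann–Lebesgue lemma** for a phase without stationary points. -/
theorem tendsto_setIntegral_exp_phase {S : Set ℝ} (hS : MeasurableSet S) {f f' : ℝ → ℝ}
    (hf : ∀ x ∈ S, HasDerivAt f (f' x) x) (hinj : InjOn f S) (hf0 : ∀ x ∈ S, f' x ≠ 0)
    (A : ℝ → ℂ) :
    Tendsto (fun c : ℝ => ∫ x in S, Complex.exp (Complex.I * c * f x) * A x)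
      (cocompact ℝ) (𝓝 0) := by
  set h := Function.invFunOn f S
  have hh : ∀ x ∈ S, h (f x) = x := fun x hx => hinj.leftInvOn_invFunOn hx
  have himg : MeasurableSet (f '' S) :=
    hS.image_of_continuousOn_injOn (fun x hx => (hf x hx).continuousAt.continuousWithinAt) hinj
  let g : ℝ → ℂ := (f '' S).indicator fun u => |f' (h u)|⁻¹ • A (h u)
  have key := Real.tendsto_integral_exp_smul_cocompact g
  have hpi : (-(2 * Real.pi)⁻¹ : ℝ) ≠ 0 := by
    simp [Real.pi_ne_zero]
  have hscale : Tendsto (fun c : ℝ => -(2 * Real.pi)⁻¹ * c) (cocompact ℝ) (cocompact ℝ) :=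
    (Homeomorph.mulLeft₀ _ hpi).isClosedEmbedding.tendsto_cocompact
  refine (key.comp hscale).congr fun c => ?_
  have h1 : ∀ v : ℝ, Real.fourierChar (-(v * (-(2 * Real.pi)⁻¹ * c))) • g v =
      (f '' S).indicator
        (fun u => Complex.exp (Complex.I * c * u) * (|f' (h u)|⁻¹ • A (h u))) v := by
    intro v
    have : Real.fourierChar (-(v * (-(2 * Real.pi)⁻¹ * c))) • g v =
        Complex.exp (Complex.I * c * v) * g v := by
      rw [Circle.smul_def, Real.fourierChar_apply, smul_eq_mul]
      congr 2
      have := Real.pi_ne_zero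
      have e : 2 * Real.pi * -(v * (-(2 * Real.pi)⁻¹ * c)) = c * v := by field_simp
      rw [e]; push_cast; ring
    rw [this]
    by_cases hv : v ∈ f '' S <;> simp [g, hv]
  simp only [Function.comp_apply, h1]
  rw [integral_indicator himg,
    integral_image_eq_integral_abs_deriv_smul hS (fun x hx => (hf x hx).hasDerivWithinAt) hinj]
  refine setIntegral_congr_fun hS fun x hx => ?_
  have : ((|f' x| : ℝ) : ℂ) ≠ 0 := by simpa using hf0 x hx
  simp only [hh x hx, Complex.real_smul]
  push_cast
  field_simp

/-- The Riemann–Lebesgue lemma with amplitudes that converge boundedly. -/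
theorem tendsto_setIntegral_exp_phase_of_bounded {S : Set ℝ} (hS : MeasurableSet S)
    (hvol : volume S ≠ ⊤) {f f' : ℝ → ℝ}
    (hf : ∀ x ∈ S, HasDerivAt f (f' x) x) (hinj : InjOn f S) (hf0 : ∀ x ∈ S, f' x ≠ 0)
    {B : ℕ → ℝ → ℂ} {A : ℝ → ℂ} {C : ℝ} (hB : ∀ n, Continuous (B n))
    (hBC : ∀ n x, ‖B n x‖ ≤ C) (hlim : ∀ x ∈ S, Tendsto (fun n => B n x) atTop (𝓝 (A x)))
    {c : ℕ → ℝ} (hc : Tendsto c atTop (cocompact ℝ)) :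
    Tendsto (fun n => ∫ x in S, Complex.exp (Complex.I * c n * f x) * B n x) atTop (𝓝 0) := by
  have : IsFiniteMeasure (volume.restrict S) := ⟨by simpa using hvol.lt_top⟩
  have hlim' : ∀ᵐ x ∂volume.restrict S, Tendsto (fun n => B n x) atTop (𝓝 (A x)) :=
    (ae_restrict_iff' hS).2 (ae_of_all _ hlim)
  have hAC : ∀ᵐ x ∂volume.restrict S, ‖A x‖ ≤ C := hlim'.mono fun x hx =>
    le_of_tendsto hx.norm (Eventually.of_forall fun n => hBC n x)
  have hAm : AEStronglyMeasurable A (volume.restrict S) :=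
    aestronglyMeasurable_of_tendsto_ae atTop (fun n => (hB n).aestronglyMeasurable) hlim'
  have hfc : ContinuousOn f S := fun x hx => (hf x hx).continuousAt.continuousWithinAt
  have hE : ∀ n, AEStronglyMeasurable (fun x => Complex.exp (Complex.I * c n * f x))
      (volume.restrict S) := fun n => by
    refine ContinuousOn.aestronglyMeasurable ?_ hS
    exact Complex.continuous_exp.comp_continuousOn
      (continuousOn_const.mul (Complex.continuous_ofReal.comp_continuousOn hfc))
  have hnorm : ∀ n x, ‖Complex.exp (Complex.I * c n * f x)‖ = 1 := fun n x => by
    rw [mul_assoc, ← Complex.ofReal_mul, mul_comm, Complex.norm_exp_ofReal_mul_I]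
  have hdiff : Tendsto (fun n => ∫ x in S, Complex.exp (Complex.I * c n * f x) * (B n x - A x))
      atTop (𝓝 (∫ _ in S, (0 : ℂ))) := by
    refine tendsto_integral_of_dominated_convergence (fun _ => C + C) (fun n => ?_)
      (integrable_const _) (fun n => ?_) ?_
    · exact (hE n).mul ((hB n).aestronglyMeasurable.sub hAm)
    · filter_upwards [hAC] with x hx
      rw [norm_mul, hnorm, one_mul]
      exact (norm_sub_le _ _).trans (add_le_add (hBC n x) hx)
    · filter_upwards [hlim'] with x hx
      rw [tendsto_zero_iff_norm_tendsto_zero]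
      simp only [norm_mul, hnorm, one_mul]
      exact tendsto_iff_norm_sub_tendsto_zero.1 hx
  have hmain := (tendsto_setIntegral_exp_phase hS hf hinj hf0 A).comp hc
  have := hdiff.add hmain
  simp only [integral_zero, add_zero] at this
  refine this.congr fun n => ?_
  simp only [Function.comp_apply]
  rw [← integral_add]
  · refine integral_congr_ae (ae_of_all _ fun x => ?_)
    simp only; ring
  · refine Integrable.of_bound (C := C + C) ((hE n).mul ((hB n).aestronglyMeasurable.sub hAm)) ?_
    filter_upwards [hAC] with x hx
    rw [norm_mul, hnorm, one_mul]
    exact (norm_sub_le _ _).trans (add_le_add (hBC n x) hx)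
  · refine Integrable.of_bound (C := C) ((hE n).mul hAm) ?_
    filter_upwards [hAC] with x hx
    rwa [norm_mul, hnorm, one_mul]

/-- The angle `φ` with `cos φ = s cos θ`. -/
noncomputable def contractedAngle (s θ : ℝ) : ℝ := Real.arccos (s * Real.cos θ)

theorem one_sub_sq_le_one_sub_mul_cos_sq (s θ : ℝ) :
    1 - s ^ 2 ≤ 1 - (s * Real.cos θ) ^ 2 := by
  nlinarith [Real.cos_sq_le_one θ, sq_nonneg s]

theorem mul_cos_mem_Ioo {s : ℝ} (hs0 : 0 < s) (hs1 : s < 1) (θ : ℝ) :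
    s * Real.cos θ ∈ Ioo (-1) 1 := by
  constructor <;> nlinarith [Real.cos_le_one θ, Real.neg_one_le_cos θ]

theorem sin_contractedAngle (s θ : ℝ) :
    Real.sin (contractedAngle s θ) = √(1 - (s * Real.cos θ) ^ 2) := Real.sin_arccos _

theorem sqrt_le_sin_contractedAngle (s θ : ℝ) :
    √(1 - s ^ 2) ≤ Real.sin (contractedAngle s θ) := by
  rw [sin_contractedAngle]
  exact Real.sqrt_le_sqrt (one_sub_sq_le_one_sub_mul_cos_sq s θ)

theorem sqrt_one_sub_sq_pos {s : ℝ} (hs0 : 0 < s) (hs1 : s < 1) : 0 < √(1 - s ^ 2) :=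
  Real.sqrt_pos.2 (by nlinarith)

theorem sin_contractedAngle_pos {s : ℝ} (hs0 : 0 < s) (hs1 : s < 1) (θ : ℝ) :
    0 < Real.sin (contractedAngle s θ) :=
  (sqrt_one_sub_sq_pos hs0 hs1).trans_le (sqrt_le_sin_contractedAngle s θ)

theorem continuous_contractedAngle (s : ℝ) : Continuous (contractedAngle s) :=
  Real.continuous_arccos.comp (continuous_const.mul Real.continuous_cos)

theorem hasDerivAt_contractedAngle {s : ℝ} (hs0 : 0 < s) (hs1 : s < 1) (θ : ℝ) :
    HasDerivAt (contractedAngle s) (s * Real.sin θ / √(1 - (s * Real.cos θ) ^ 2)) θ := by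
  have h := mul_cos_mem_Ioo hs0 hs1 θ
  convert! (Real.hasDerivAt_arccos h.1.ne' h.2.ne).comp θ ((Real.hasDerivAt_cos θ).const_mul s)
    using 1
  ring

theorem injOn_mul_cos {s : ℝ} (hs0 : 0 < s) :
    InjOn (fun θ => s * Real.cos θ) (Ioo 0 Real.pi) := fun _ hx _ hy h =>
  Real.injOn_cos (Ioo_subset_Icc_self hx) (Ioo_subset_Icc_self hy)
    (mul_left_cancel₀ hs0.ne' h)

theorem injOn_contractedAngle {s : ℝ} (hs0 : 0 < s) (hs1 : s < 1) :
    InjOn (contractedAngle s) (Ioo 0 Real.pi) := fun x hx y hy h =>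
  injOn_mul_cos hs0 hx hy
    (Real.arccos_injOn (Ioo_subset_Icc_self (mul_cos_mem_Ioo hs0 hs1 x))
      (Ioo_subset_Icc_self (mul_cos_mem_Ioo hs0 hs1 y)) h)

theorem contractedAngle_add_pi (s θ : ℝ) :
    contractedAngle s (θ + Real.pi) = Real.pi - contractedAngle s θ := by
  simp [contractedAngle, Real.arccos_neg]

theorem chebyshevU_eval_mul_cos {s : ℝ} (hs0 : 0 < s) (hs1 : s < 1) (n : ℕ) (θ : ℝ) :
    (Polynomial.Chebyshev.U ℝ ((n : ℤ) - 1)).eval (s * Real.cos θ) =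
      Real.sin (n * contractedAngle s θ) / Real.sin (contractedAngle s θ) := by
  have h := mul_cos_mem_Ioo hs0 hs1 θ
  rw [eq_div_iff (sin_contractedAngle_pos hs0 hs1 θ).ne']
  have := Polynomial.Chebyshev.U_real_cos (contractedAngle s θ) ((n : ℤ) - 1)
  rw [contractedAngle, Real.cos_arccos h.1.le h.2.le] at this
  rw [contractedAngle, this]
  push_cast; congr 1; ring

theorem chebyshevU_eval_mul_cos_add_pi {s : ℝ} (hs0 : 0 < s) (hs1 : s < 1) (n : ℕ) (θ : ℝ) :
    (Polynomial.Chebyshev.U ℝ ((n : ℤ) - 1)).eval (s * Real.cos (θ + Real.pi)) =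
      -((-1) ^ n * (Polynomial.Chebyshev.U ℝ ((n : ℤ) - 1)).eval (s * Real.cos θ)) := by
  rw [chebyshevU_eval_mul_cos hs0 hs1, chebyshevU_eval_mul_cos hs0 hs1, contractedAngle_add_pi,
    mul_sub, Real.sin_nat_mul_pi_sub, Real.sin_pi_sub]
  ring

theorem continuous_chebyshevU_eval (n : ℤ) :
    Continuous fun x => (Polynomial.Chebyshev.U ℝ n).eval x := Polynomial.continuous _

/-- By the symmetry `θ ↦ θ + π`, the integral defining `Dnk` reduces to half a period. -/
theorem Dnk_eq_half_period {s : ℝ} (hs0 : 0 < s) (hs1 : s < 1) (k : ℤ) (ξ : ℝ) (n : ℕ) :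
    Dnk s k ξ n = (((1 + (-1 : ℝ) ^ k) / (2 * Real.pi) : ℝ) : ℂ) *
      ∫ θ in Ioo 0 Real.pi, Complex.exp (Complex.I * k * θ) *
        Complex.ofReal ((Polynomial.Chebyshev.U ℝ ((n : ℤ) - 1)).eval
          (s * Real.cos (θ + ξ / n))) *
        Complex.ofReal ((Polynomial.Chebyshev.U ℝ ((n : ℤ) - 1)).eval (s * Real.cos θ)) := by
  rw [Dnk]
  set E : ℝ → ℂ := fun θ => Complex.exp (Complex.I * k * θ) *
    Complex.ofReal ((Polynomial.Chebyshev.U ℝ ((n : ℤ) - 1)).eval (s * Real.cos (θ + ξ / n))) *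
    Complex.ofReal ((Polynomial.Chebyshev.U ℝ ((n : ℤ) - 1)).eval (s * Real.cos θ)) with hE
  have hc : Continuous E := by
    have := continuous_chebyshevU_eval ((n : ℤ) - 1)
    have h1 : Continuous fun θ =>
        (Polynomial.Chebyshev.U ℝ ((n : ℤ) - 1)).eval (s * Real.cos (θ + ξ / n)) :=
      this.comp (by fun_prop)
    have h2 : Continuous fun θ =>
        (Polynomial.Chebyshev.U ℝ ((n : ℤ) - 1)).eval (s * Real.cos θ) :=
      this.comp (by fun_prop)
    exact ((by fun_prop : Continuous fun θ : ℝ => Complex.exp (Complex.I * k * θ)).mul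
      (Complex.continuous_ofReal.comp h1)).mul (Complex.continuous_ofReal.comp h2)
  have hshift : ∀ θ, E (θ + Real.pi) = ((-1 : ℝ) ^ k : ℝ) * E θ := by
    intro θ
    have h1 : Complex.exp (Complex.I * k * (θ + Real.pi : ℝ)) =
        ((-1 : ℝ) ^ k : ℝ) * Complex.exp (Complex.I * k * θ) := by
      have : Complex.I * k * (θ + Real.pi : ℝ) =
          k * (Real.pi * Complex.I) + Complex.I * k * θ := by push_cast; ring
      rw [this, Complex.exp_add, Complex.exp_int_mul, Complex.exp_pi_mul_I]
      push_cast; rfl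
    have h2 : ((-1 : ℂ) ^ n) * (-1) ^ n = 1 := by rw [← mul_pow]; simp
    simp only [hE]
    rw [h1, add_right_comm, chebyshevU_eval_mul_cos_add_pi hs0 hs1,
      chebyshevU_eval_mul_cos_add_pi hs0 hs1]
    generalize (Polynomial.Chebyshev.U ℝ ((n : ℤ) - 1)).eval (s * Real.cos (θ + ξ / n)) = a
    generalize (Polynomial.Chebyshev.U ℝ ((n : ℤ) - 1)).eval (s * Real.cos θ) = b
    push_cast
    linear_combination ((-1 : ℂ) ^ k * Complex.exp (Complex.I * k * θ) * a * b) * h2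
  have hsecond : ∫ θ in Real.pi..(2 * Real.pi), E θ =
      ((-1 : ℝ) ^ k : ℝ) * ∫ θ in (0 : ℝ)..Real.pi, E θ := by
    have := intervalIntegral.integral_comp_add_right (a := 0) (b := Real.pi) E Real.pi
    rw [zero_add, ← two_mul] at this
    rw [← this, ← intervalIntegral.integral_const_mul]
    simp only [hshift]
  rw [← intervalIntegral.integral_add_adjacent_intervals (hc.intervalIntegrable 0 Real.pi)
    (hc.intervalIntegrable _ _), hsecond, intervalIntegral.integral_of_le Real.pi_pos.le,
    integral_Ioc_eq_integral_Ioo]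
  push_cast
  ring

theorem tendsto_mul_sub_of_hasDerivAt {f : ℝ → ℝ} {f' x : ℝ} (hf : HasDerivAt f f' x) (ξ : ℝ) :
    Tendsto (fun n : ℕ => n * (f (x + ξ / n) - f x)) atTop (𝓝 (ξ * f')) := by
  have h : HasDerivAt (fun t => f (x + ξ * t)) (ξ * f') 0 := by
    have hi : HasDerivAt (fun t => x + ξ * t) ξ 0 := by
      simpa using ((hasDerivAt_id (0 : ℝ)).const_mul ξ).const_add x
    have hf2 : HasDerivAt f f' (x + ξ * 0) := by simpa using hf
    simpa [mul_comm] using! hf2.comp (0 : ℝ) hi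
  have hn : Tendsto (fun n : ℕ => ((n : ℝ))⁻¹) atTop (𝓝[≠] 0) :=
    (tendsto_inv_atTop_nhdsGT_zero.comp tendsto_natCast_atTop_atTop).mono_right
      (nhdsWithin_mono _ fun _ hx => ne_of_gt hx)
  refine (h.tendsto_slope_zero.comp hn).congr fun n => ?_
  simp [div_eq_mul_inv]

theorem exp_mul_sin_mul_sin_div (w p q : ℂ) (n φ δ : ℝ) :
    w * (Real.sin (n * φ + δ) / p : ℂ) * (Real.sin (n * φ) / q : ℂ) =
      2⁻¹ * (w / (p * q) * Real.cos δ) -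
      4⁻¹ * (Complex.exp (Complex.I * (2 * n : ℝ) * φ) *
        (w / (p * q) * Complex.exp (Complex.I * δ))) -
      4⁻¹ * (Complex.exp (Complex.I * (-(2 * n) : ℝ) * φ) *
        (w / (p * q) * Complex.exp (Complex.I * (-δ : ℝ)))) := by
  have h1 : (Real.sin (n * φ + δ) : ℂ) * Real.sin (n * φ) =
      2⁻¹ * (Real.cos δ - Real.cos (2 * n * φ + δ)) := by
    have : Real.sin (n * φ + δ) * Real.sin (n * φ) =
        2⁻¹ * (Real.cos δ - Real.cos (2 * n * φ + δ)) := by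
      have e1 : Real.cos δ = Real.cos ((n * φ + δ) - n * φ) := by congr 1; ring
      have e2 : Real.cos (2 * n * φ + δ) = Real.cos ((n * φ + δ) + n * φ) := by congr 1; ring
      rw [e1, e2, Real.cos_sub _ (n * φ), Real.cos_add _ (n * φ)]; ring
    rw [← Complex.ofReal_mul, this]
    push_cast; rfl
  have h2 : (Real.cos (2 * n * φ + δ) : ℂ) =
      2⁻¹ * (Complex.exp (Complex.I * (2 * n : ℝ) * φ) * Complex.exp (Complex.I * δ) +
        Complex.exp (Complex.I * (-(2 * n) : ℝ) * φ) * Complex.exp (Complex.I * (-δ : ℝ))) := by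
    rw [← Complex.exp_add, ← Complex.exp_add, Complex.ofReal_cos, Complex.cos]
    push_cast
    ring_nf
  have h3 : w * (Real.sin (n * φ + δ) / p : ℂ) * (Real.sin (n * φ) / q : ℂ) =
      w / (p * q) * (Real.sin (n * φ + δ) * Real.sin (n * φ)) := by
    field_simp
  rw [h3, h1, h2]
  ring

/-- The limit over half a period, in the angular variable. -/
theorem tendsto_half_period {s : ℝ} (hs0 : 0 < s) (hs1 : s < 1) (k : ℤ) (ξ : ℝ) :
    Tendsto (fun n : ℕ => ∫ θ in Ioo 0 Real.pi, Complex.exp (Complex.I * k * θ) *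
        Complex.ofReal ((Polynomial.Chebyshev.U ℝ ((n : ℤ) - 1)).eval
          (s * Real.cos (θ + ξ / n))) *
        Complex.ofReal ((Polynomial.Chebyshev.U ℝ ((n : ℤ) - 1)).eval (s * Real.cos θ)))
      atTop (𝓝 (2⁻¹ * ∫ θ in Ioo 0 Real.pi, Complex.exp (Complex.I * k * θ) /
        ((1 - (s * Real.cos θ) ^ 2 : ℝ) : ℂ) *
        Complex.ofReal (Real.cos (ξ * (s * Real.sin θ / √(1 - (s * Real.cos θ) ^ 2)))))) := by
  set S := Ioo 0 Real.pi with hS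
  set φ := contractedAngle s with hφ
  have hφc : Continuous φ := continuous_contractedAngle s
  have hsin : ∀ θ, 0 < Real.sin (φ θ) := sin_contractedAngle_pos hs0 hs1
  have hsinC : ∀ θ, (Real.sin (φ θ) : ℂ) ≠ 0 := fun θ => by exact_mod_cast (hsin θ).ne'
  let δ : ℕ → ℝ → ℝ := fun n θ => n * (φ (θ + ξ / n) - φ θ)
  let δ' : ℝ → ℝ := fun θ => ξ * (s * Real.sin θ / √(1 - (s * Real.cos θ) ^ 2))
  let W : ℕ → ℝ → ℂ := fun n θ => Complex.exp (Complex.I * k * θ) /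
    ((Real.sin (φ (θ + ξ / n)) : ℂ) * Real.sin (φ θ))
  let W' : ℝ → ℂ := fun θ => Complex.exp (Complex.I * k * θ) / ((1 - (s * Real.cos θ) ^ 2 : ℝ) : ℂ)
  have hshiftc : ∀ n : ℕ, Continuous fun θ => φ (θ + ξ / n) := fun n =>
    hφc.comp (continuous_id.add continuous_const)
  have hδc : ∀ n, Continuous (δ n) := fun n => continuous_const.mul ((hshiftc n).sub hφc)
  have hWc : ∀ n, Continuous (W n) := fun n => by
    refine Continuous.div (by fun_prop) ?_ fun θ => mul_ne_zero (hsinC _) (hsinC _)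
    exact (Complex.continuous_ofReal.comp (Real.continuous_sin.comp (hshiftc n))).mul
      (Complex.continuous_ofReal.comp (Real.continuous_sin.comp hφc))
  set C : ℝ := 1 / (√(1 - s ^ 2) * √(1 - s ^ 2)) with hC
  have hpos := sqrt_one_sub_sq_pos hs0 hs1
  have hWC : ∀ n θ, ‖W n θ‖ ≤ C := fun n θ => by
    have : ‖Complex.exp (Complex.I * k * θ)‖ = 1 := by
      rw [mul_assoc, mul_comm]
      exact_mod_cast Complex.norm_exp_ofReal_mul_I (k * θ)
    rw [norm_div, this, norm_mul, Complex.norm_real, Complex.norm_real, Real.norm_of_nonneg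
      (hsin _).le, Real.norm_of_nonneg (hsin _).le]
    exact one_div_le_one_div_of_le (mul_pos hpos hpos)
      (mul_le_mul (sqrt_le_sin_contractedAngle s _) (sqrt_le_sin_contractedAngle s _)
        hpos.le (hsin _).le)
  have hδlim : ∀ θ, Tendsto (fun n => δ n θ) atTop (𝓝 (δ' θ)) := fun θ =>
    tendsto_mul_sub_of_hasDerivAt (hasDerivAt_contractedAngle hs0 hs1 θ) ξ
  have hWlim : ∀ θ, Tendsto (fun n => W n θ) atTop (𝓝 (W' θ)) := fun θ => by
    have hsq : ((1 - (s * Real.cos θ) ^ 2 : ℝ) : ℂ) = Real.sin (φ θ) * Real.sin (φ θ) := by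
      have h0 : 0 ≤ 1 - (s * Real.cos θ) ^ 2 :=
        le_trans (by nlinarith) (one_sub_sq_le_one_sub_mul_cos_sq s θ)
      rw [hφ, sin_contractedAngle, ← Complex.ofReal_mul, Real.mul_self_sqrt h0]
    have harg : Tendsto (fun n : ℕ => θ + ξ / n) atTop (𝓝 θ) := by
      simpa using (tendsto_const_div_atTop_nhds_zero_nat ξ).const_add θ
    have h1 : Tendsto (fun n : ℕ => (Real.sin (φ (θ + ξ / n)) : ℂ)) atTop
        (𝓝 (Real.sin (φ θ) : ℂ)) :=
      ((Complex.continuous_ofReal.comp (Real.continuous_sin.comp hφc)).tendsto θ).comp harg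
    simp only [W', hsq]
    exact tendsto_const_nhds.div (h1.mul_const _) (mul_ne_zero (hsinC _) (hsinC _))
  have hvol : volume S ≠ ⊤ := by simp [hS]
  have : IsFiniteMeasure (volume.restrict S) := ⟨by simpa using hvol.lt_top⟩
  have hexp : ∀ x : ℝ, ‖Complex.exp (Complex.I * x)‖ = 1 := fun x => by
    rw [mul_comm, Complex.norm_exp_ofReal_mul_I]
  have hRL : ∀ σ : ℝ, σ ≠ 0 → Tendsto (fun n : ℕ => ∫ θ in S,
      Complex.exp (Complex.I * (σ * (2 * n) : ℝ) * φ θ) *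
        (W n θ * Complex.exp (Complex.I * (σ * δ n θ : ℝ)))) atTop (𝓝 0) := by
    intro σ hσ
    refine tendsto_setIntegral_exp_phase_of_bounded measurableSet_Ioo hvol
      (fun θ _ => hasDerivAt_contractedAngle hs0 hs1 θ) (injOn_contractedAngle hs0 hs1)
      (fun θ hθ => ?_) (A := fun θ => W' θ * Complex.exp (Complex.I * (σ * δ' θ : ℝ))) (C := C)
      (fun n => ?_) (fun n θ => ?_) (fun θ _ => ?_) (c := fun n : ℕ => σ * (2 * n)) ?_
    · have := Real.sin_pos_of_pos_of_lt_pi hθ.1 hθ.2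
      rw [← sin_contractedAngle]
      exact (div_pos (mul_pos hs0 this) (hsin θ)).ne'
    · have := hδc n
      exact (hWc n).mul (by fun_prop)
    · rw [norm_mul, hexp, mul_one]
      exact hWC n θ
    · refine (hWlim θ).mul ?_
      exact ((by fun_prop : Continuous fun x : ℝ => Complex.exp (Complex.I * (σ * x : ℝ))).tendsto
        (δ' θ)).comp (hδlim θ)
    · have h2 : Tendsto (fun n : ℕ => (n : ℝ)) atTop (cocompact ℝ) :=
        tendsto_natCast_atTop_atTop.mono_right atTop_le_cocompact
      have h3 := (Homeomorph.mulLeft₀ (σ * 2)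
        (mul_ne_zero hσ two_ne_zero)).isClosedEmbedding.tendsto_cocompact.comp h2
      refine h3.congr fun n => ?_
      simp [mul_assoc]
  have hcos : Tendsto (fun n : ℕ => ∫ θ in S, W n θ * Real.cos (δ n θ)) atTop
      (𝓝 (∫ θ in S, W' θ * Real.cos (δ' θ))) := by
    refine tendsto_integral_of_dominated_convergence (fun _ => C) (fun n => ?_)
      (integrable_const _) (fun n => ae_of_all _ fun θ => ?_) (ae_of_all _ fun θ => ?_)
    · exact ((hWc n).mul (Complex.continuous_ofReal.comp
        (Real.continuous_cos.comp (hδc n)))).aestronglyMeasurable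
    · rw [norm_mul, Complex.norm_real]
      exact (mul_le_of_le_one_right (norm_nonneg _) (Real.abs_cos_le_one _)).trans (hWC n θ)
    · exact (hWlim θ).mul (((Complex.continuous_ofReal.comp Real.continuous_cos).tendsto _).comp
        (hδlim θ))
  have hint : ∀ g : ℝ → ℂ, Continuous g → Integrable g (volume.restrict S) := fun g hg =>
    (hg.integrableOn_Icc (a := 0) (b := Real.pi)).mono_set Ioo_subset_Icc_self
  have htotal := ((hcos.const_mul (2⁻¹ : ℂ)).sub ((hRL 1 one_ne_zero).const_mul (4⁻¹ : ℂ))).sub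
    ((hRL (-1) (by norm_num)).const_mul (4⁻¹ : ℂ))
  simp only [mul_zero, sub_zero] at htotal
  refine htotal.congr fun n => ?_
  have hi1 := hint _ ((hWc n).mul (Complex.continuous_ofReal.comp
    (Real.continuous_cos.comp (hδc n))))
  have hi2 : ∀ σ : ℝ, Integrable (fun θ => Complex.exp (Complex.I * (σ * (2 * n) : ℝ) * φ θ) *
      (W n θ * Complex.exp (Complex.I * (σ * δ n θ : ℝ)))) (volume.restrict S) := fun σ =>
    hint _ ((Complex.continuous_exp.comp (continuous_const.mul
      (Complex.continuous_ofReal.comp hφc))).mul ((hWc n).mul (Complex.continuous_exp.comp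
        (continuous_const.mul (Complex.continuous_ofReal.comp (continuous_const.mul (hδc n)))))))
  rw [← integral_const_mul, ← integral_const_mul, ← integral_const_mul, ← integral_sub,
    ← integral_sub]
  · refine integral_congr_ae (ae_of_all _ fun θ => ?_)
    simp only [chebyshevU_eval_mul_cos hs0 hs1]
    have harg : (n : ℝ) * contractedAngle s (θ + ξ / n) = n * φ θ + δ n θ := by
      simp only [δ, hφ]; ring
    have := exp_mul_sin_mul_sin_div (Complex.exp (Complex.I * k * θ))
      (Real.sin (φ (θ + ξ / n))) (Real.sin (φ θ)) n (φ θ) (δ n θ)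
    rw [harg]
    simp only [one_mul, neg_mul]
    rw [Complex.ofReal_div, Complex.ofReal_div]
    exact this.symm
  · exact (hi1.const_mul _).sub ((hi2 1).const_mul _)
  · exact (hi2 (-1)).const_mul _
  · exact hi1.const_mul _
  · exact (hi2 1).const_mul _

theorem image_mul_cos_Ioo {s : ℝ} (hs0 : 0 < s) :
    (fun θ => s * Real.cos θ) '' Ioo 0 Real.pi = Ioo (-s) s := by
  ext x
  constructor
  · rintro ⟨θ, hθ, rfl⟩
    have h1 := Real.strictAntiOn_cos (left_mem_Icc.2 Real.pi_pos.le)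
      (Ioo_subset_Icc_self hθ) hθ.1
    have h2 := Real.strictAntiOn_cos (Ioo_subset_Icc_self hθ)
      (right_mem_Icc.2 Real.pi_pos.le) hθ.2
    rw [Real.cos_zero] at h1
    rw [Real.cos_pi] at h2
    constructor <;> simp only <;> nlinarith
  · rintro ⟨h1, h2⟩
    have h3 : -1 < x / s := by rw [lt_div_iff₀ hs0]; linarith
    have h4 : x / s < 1 := by rw [div_lt_iff₀ hs0]; linarith
    refine ⟨Real.arccos (x / s), ⟨Real.arccos_pos.2 h4, Real.arccos_lt_pi.2 h3⟩, ?_⟩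
    simp only
    rw [Real.cos_arccos h3.le h4.le]
    field_simp

/-- The substitution `x = s cos θ`. -/
theorem integral_ek_eq_integral_angle {s : ℝ} (hs0 : 0 < s) (k : ℤ) (ξ : ℝ) :
    ∫ x in (-s)..s, ek s k x *
        Complex.ofReal (Real.cos (ξ * Real.sqrt (s ^ 2 - x ^ 2) / Real.sqrt (1 - x ^ 2))) *
        Complex.ofReal (((1 - x ^ 2) * Real.sqrt (s ^ 2 - x ^ 2))⁻¹) =
      ∫ θ in Ioo 0 Real.pi, Complex.exp (Complex.I * k * θ) /
        ((1 - (s * Real.cos θ) ^ 2 : ℝ) : ℂ) *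
        Complex.ofReal (Real.cos (ξ * (s * Real.sin θ / √(1 - (s * Real.cos θ) ^ 2)))) := by
  rw [intervalIntegral.integral_of_le (by linarith), integral_Ioc_eq_integral_Ioo,
    ← image_mul_cos_Ioo hs0, integral_image_eq_integral_abs_deriv_smul measurableSet_Ioo
      (fun θ _ => ((Real.hasDerivAt_cos θ).const_mul s).hasDerivWithinAt) (injOn_mul_cos hs0)]
  refine setIntegral_congr_fun measurableSet_Ioo fun θ hθ => ?_
  have hsin := Real.sin_pos_of_pos_of_lt_pi hθ.1 hθ.2
  have hpos : 0 < s * Real.sin θ := mul_pos hs0 hsin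
  have h1 : √(s ^ 2 - (s * Real.cos θ) ^ 2) = s * Real.sin θ := by
    rw [← Real.sqrt_sq hpos.le]
    congr 1
    rw [mul_pow, mul_pow, Real.sin_sq]; ring
  have h2 : |s * -Real.sin θ| = s * Real.sin θ := by rw [mul_neg, abs_neg, abs_of_pos hpos]
  have h3 : Real.arccos (s * Real.cos θ / s) = θ := by
    rw [mul_div_cancel_left₀ _ hs0.ne', Real.arccos_cos hθ.1.le hθ.2.le]
  simp only [ek, h1, h2, h3, Complex.real_smul, mul_div_assoc ξ]
  generalize 1 - (s * Real.cos θ) ^ 2 = d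
  generalize s * Real.sin θ = a at hpos ⊢
  have ha : (a : ℂ) ≠ 0 := by exact_mod_cast hpos.ne'
  rw [Complex.ofReal_inv, Complex.ofReal_mul, mul_inv]
  field_simp

/-- The limit of `D_{n,k}(ξ)` as `n → ∞`. -/
theorem Dnk_limit (s : ℝ) (hs0 : 0 < s) (hs1 : s < 1) (k : ℤ) (ξ : ℝ) :
    Filter.Tendsto (fun n : ℕ => Dnk s k ξ n) Filter.atTop
      (nhds ((((1 + (-1 : ℝ) ^ k) / (4 * Real.pi) : ℝ) : ℂ) *
        ∫ x in (-s)..s,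
          ek s k x *
            Complex.ofReal (Real.cos (ξ * Real.sqrt (s ^ 2 - x ^ 2) / Real.sqrt (1 - x ^ 2))) *
            Complex.ofReal (((1 - x ^ 2) * Real.sqrt (s ^ 2 - x ^ 2))⁻¹))) := by
  rw [integral_ek_eq_integral_angle hs0]
  have h := (tendsto_half_period hs0 hs1 k ξ).const_mul
    (((1 + (-1 : ℝ) ^ k) / (2 * Real.pi) : ℝ) : ℂ)
  simp only [← Dnk_eq_half_period hs0 hs1] at h
  convert h using 2
  rw [← mul_assoc]
  congr 1
  push_cast
  ring
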